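/- arXiv:2310.10816 — 3 statements merged into one kernel-verified Lean document; each statement's English description precedes it below -/
import Mathlib

section
/- For any non-degenerate tetrahedron in R^3 with circumradius R, inradius r, and distance d between circumcenter and incenter, (R - 3r)(R + r) >= d^2 (Grace-Danielsson inequality). -/
open EuclideanGeometry Affine

namespace AffineBasis

section Module

variable {ι k V : Type*} [Ring k] [AddCommGroup V] [Module k V] (b : AffineBasis ι k V)

lemma coord_linear_apply (i : ι) (y : V) :
    (b.coord i).linear y = b.coord i y - b.coord i 0 := by
  simpa using (b.coord i).linearMap_vsub y 0

lemma mem_affineSpan_image_of_coord_eq_zero [Nontrivial k] [Fintype ι] {i : ι} {p : V}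
    (hp : b.coord i p = 0) : p ∈ affineSpan k (b '' {j | j ≠ i}) := by
  classical
  have h := affineCombination_mem_affineSpan_image (s' := {j | j ≠ i})
    (b.sum_coord_apply_eq_one p) (fun j _ hj => by
      obtain rfl : j = i := by simpa using hj
      exact hp) b
  rwa [b.affineCombination_coord_eq_self] at h

lemma sum_coord_linear [Fintype ι] (y : V) : ∑ i, (b.coord i).linear y = 0 := by
  simp only [coord_linear_apply, Finset.sum_sub_distrib, sum_coord_apply_eq_one, sub_self]

lemma sum_coord_smul_sub [Fintype ι] (p o : V) : ∑ i, b.coord i p • (b i - o) = p - o := by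
  simp only [smul_sub, Finset.sum_sub_distrib, linear_combination_coord_eq_self,
    ← Finset.sum_smul, sum_coord_apply_eq_one, one_smul]

lemma sum_coord_linear_smul_sub [Fintype ι] (y o : V) :
    ∑ i, (b.coord i).linear y • (b i - o) = y := by
  simp only [coord_linear_apply, sub_smul, Finset.sum_sub_distrib, sum_coord_smul_sub]
  simp

/-- The identity map of `V`, written as `y ↦ ∑ i, (b.coord i).linear y • (b i - o)`, has trace
the dimension of `V`. -/
lemma sum_coord_linear_sub [Fintype ι] (o : V) :
    ∑ i, (b.coord i).linear (b i - o) = Fintype.card ι - 1 := by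
  have h (i : ι) : (b.coord i).linear (b i - o) = 1 - b.coord i o := by
    simpa using (b.coord i).linearMap_vsub (b i) o
  simp only [h, Finset.sum_sub_distrib, sum_coord_apply_eq_one, Finset.sum_const,
    Finset.card_univ, nsmul_one]

end Module

/-- A ball centred at `p` which does not cross the face opposite to `b i` bounds the growth of the
`i`th barycentric coordinate. -/
lemma neg_mul_coord_linear_le {ι V : Type*} [Fintype ι] [NormedAddCommGroup V] [NormedSpace ℝ V]
    (b : AffineBasis ι ℝ V) {i : ι} {p : V} {r : ℝ} (hp : 0 ≤ b.coord i p) (hr0 : 0 ≤ r)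
    (hr : r ≤ Metric.infDist p (affineSpan ℝ (b '' {j | j ≠ i}) : Set V)) (y : V) :
    -(r * (b.coord i).linear y) ≤ b.coord i p * ‖y‖ := by
  by_cases hy : (b.coord i).linear y = 0
  · rw [hy, mul_zero, neg_zero]
    positivity
  have hmem : p - (b.coord i p / (b.coord i).linear y) • y ∈
      affineSpan ℝ (b '' {j | j ≠ i}) := by
    apply b.mem_affineSpan_image_of_coord_eq_zero
    have h := (b.coord i).map_vadd p (-((b.coord i p / (b.coord i).linear y) • y))
    rw [vadd_eq_add, vadd_eq_add, neg_add_eq_sub, map_neg, map_smul, smul_eq_mul,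
      div_mul_cancel₀ _ hy] at h
    simpa using h
  have h := hr.trans (Metric.infDist_le_dist_of_mem hmem)
  rw [dist_eq_norm, sub_sub_cancel, norm_smul, Real.norm_eq_abs, abs_div, abs_of_nonneg hp,
    div_mul_eq_mul_div, le_div_iff₀ (abs_pos.2 hy)] at h
  nlinarith [neg_abs_le ((b.coord i).linear y)]

end AffineBasis

section InnerProductSpace

variable {E : Type*} [NormedAddCommGroup E] [InnerProductSpace ℝ E]

open scoped RealInnerProductSpace

/-- In the Lorentzian space `ℝ × E`, the map `x ↦ 2 ⟪w, x⟫ w - ⟪w, w⟫ x` with `w = (a, q)` sends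
the future light cone to itself: the image of `(‖v‖, v)` is again a future light-like vector. -/
lemma norm_lorentz_reflection (a : ℝ) (q v : E) :
    ‖(2 * (a * ‖v‖ - ⟪q, v⟫)) • q - (a ^ 2 - ‖q‖ ^ 2) • v‖ =
      2 * (a * ‖v‖ - ⟪q, v⟫) * a - (a ^ 2 - ‖q‖ ^ 2) * ‖v‖ := by
  have hle : ⟪q, v⟫ ≤ ‖q‖ * ‖v‖ := real_inner_le_norm q v
  have hge := abs_le.1 (abs_real_inner_le_norm q v)
  rw [← sq_eq_sq₀ (norm_nonneg _), norm_sub_sq_real, norm_smul, norm_smul, mul_pow, mul_pow,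
    real_inner_smul_left, real_inner_smul_right, Real.norm_eq_abs, Real.norm_eq_abs, sq_abs, sq_abs]
  · ring
  · rcases le_total 0 a with ha | ha
    · nlinarith [mul_nonneg (norm_nonneg v) (sq_nonneg (a - ‖q‖)), mul_le_mul_of_nonneg_left hle ha]
    · nlinarith [mul_nonneg (norm_nonneg v) (sq_nonneg (a + ‖q‖)),
        mul_le_mul_of_nonneg_left hge.1 (neg_nonneg.2 ha)]

/-- If the simplex spanned by `b` has its vertices on the sphere of radius `R` centred at `o`, and
contains the ball of radius `r` centred at `p`, then pairing the barycentric coordinates with the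
images of the vertices under a Lorentz reflection gives a nonnegative quadratic form. -/
lemma AffineBasis.lorentz_trace_nonneg {ι : Type*} [Fintype ι] (b : AffineBasis ι ℝ E)
    {o p : E} {R r : ℝ} (hR : ∀ i, dist (b i) o = R) (hp : ∀ i, 0 ≤ b.coord i p) (hr0 : 0 ≤ r)
    (hr : ∀ i, r ≤ Metric.infDist p (affineSpan ℝ (b '' {j | j ≠ i}) : Set E)) (a : ℝ) :
    0 ≤ a ^ 2 * (R - (Fintype.card ι - 1) * r) - 2 * a * dist o p ^ 2 +
      dist o p ^ 2 * (R + (Fintype.card ι - 3) * r) := by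
  have hD : dist o p = ‖p - o‖ := by rw [dist_comm, dist_eq_norm]
  rw [hD]
  set q := p - o with hq
  have hv (i : ι) : ‖b i - o‖ = R := by rw [← dist_eq_norm, hR]
  have hvertex (i : ι) : 0 ≤ b.coord i p *
        (2 * (a * R - ⟪q, b i - o⟫) * a - (a ^ 2 - ‖q‖ ^ 2) * R) +
      r * (2 * (a * R - ⟪q, b i - o⟫) * (b.coord i).linear q -
        (a ^ 2 - ‖q‖ ^ 2) * (b.coord i).linear (b i - o)) := by
    have h := b.neg_mul_coord_linear_le (hp i) hr0 (hr i)
      ((2 * (a * ‖b i - o‖ - ⟪q, b i - o⟫)) • q - (a ^ 2 - ‖q‖ ^ 2) • (b i - o))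
    rw [norm_lorentz_reflection, hv, map_sub, map_smul, map_smul, smul_eq_mul, smul_eq_mul] at h
    linarith
  have h1 : ∑ i, b.coord i p = 1 := b.sum_coord_apply_eq_one p
  have h2 : ∑ i, b.coord i p * ⟪q, b i - o⟫ = ‖q‖ ^ 2 := by
    simp only [← real_inner_smul_right, ← inner_sum, b.sum_coord_smul_sub, ← hq,
      real_inner_self_eq_norm_sq]
  have h3 := b.sum_coord_linear q
  have h4 : ∑ i, (b.coord i).linear q * ⟪q, b i - o⟫ = ‖q‖ ^ 2 := by
    simp only [← real_inner_smul_right, ← inner_sum, b.sum_coord_linear_smul_sub,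
      real_inner_self_eq_norm_sq]
  have h5 := b.sum_coord_linear_sub o
  have hsum := Finset.sum_nonneg fun i (_ : i ∈ Finset.univ) => hvertex i
  have hexpand (i : ι) : b.coord i p *
        (2 * (a * R - ⟪q, b i - o⟫) * a - (a ^ 2 - ‖q‖ ^ 2) * R) +
      r * (2 * (a * R - ⟪q, b i - o⟫) * (b.coord i).linear q -
        (a ^ 2 - ‖q‖ ^ 2) * (b.coord i).linear (b i - o)) =
      (2 * a ^ 2 * R - (a ^ 2 - ‖q‖ ^ 2) * R) * b.coord i p -
        2 * a * (b.coord i p * ⟪q, b i - o⟫) + 2 * r * a * R * (b.coord i).linear q -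
        2 * r * ((b.coord i).linear q * ⟪q, b i - o⟫) -
        r * (a ^ 2 - ‖q‖ ^ 2) * (b.coord i).linear (b i - o) := by ring
  simp only [hexpand, Finset.sum_add_distrib, Finset.sum_sub_distrib, ← Finset.mul_sum,
    h1, h2, h3, h4, h5] at hsum
  linarith

end InnerProductSpace

/-- Grace–Danielsson inequality: for a tetrahedron in `ℝ³` with circumradius `R`, inradius `r`,
and distance `d` between circumcenter and incenter, `(R - 3r)(R + r) ≥ d²`. -/
theorem grace_danielsson
    (T : Affine.Simplex ℝ (EuclideanSpace ℝ (Fin 3)) 3)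
    (I : EuclideanSpace ℝ (Fin 3)) (r : ℝ) (hr : 0 < r)
    (hI : I ∈ convexHull ℝ (Set.range T.points))
    (hdist : ∀ i : Fin 4,
      Metric.infDist I (affineSpan ℝ (T.points '' {j | j ≠ i}) : Set (EuclideanSpace ℝ (Fin 3))) = r) :
    (T.circumradius - 3 * r) * (T.circumradius + r) ≥ dist T.circumcenter I ^ 2 := by
  have hspan : affineSpan ℝ (Set.range T.points) = ⊤ := by
    rw [T.independent.affineSpan_eq_top_iff_card_eq_finrank_add_one]
    simp
  let b : AffineBasis (Fin 4) ℝ (EuclideanSpace ℝ (Fin 3)) := ⟨T.points, T.independent, hspan⟩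
  have hcoord : ∀ i, 0 ≤ b.coord i I := by
    have h : I ∈ convexHull ℝ (Set.range b) := hI
    rwa [b.convexHull_eq_nonneg_coord] at h
  have h := b.lorentz_trace_nonneg T.dist_circumcenter_eq_circumradius hcoord hr.le
    (fun i => (hdist i).ge) (T.circumradius + r)
  have ha : 0 < T.circumradius + r := by linarith [T.circumradius_nonneg]
  norm_num at h
  refine le_of_mul_le_mul_left ?_ ha
  linarith
end

section
/- For any non-degenerate n-dimensional Euclidean simplex (n >= 2) with circumradius R, inradius r, and distance d between circumcenter and incenter, (R - n r)(R + (n-2) r) >= d^2 (Egan conjecture). -/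
open EuclideanGeometry Affine

open scoped RealInnerProductSpace

/-- A point whose `i`-th barycentric coordinate vanishes lies in the affine span of the other
points of the basis. -/
lemma AffineBasis.mem_affineSpan_image_ne_of_coord_eq_zero {ι k V P : Type*} [AddCommGroup V]
    [AddTorsor V P] [Ring k] [Nontrivial k] [Module k V] [Fintype ι] (b : AffineBasis ι k P) {i : ι} {p : P}
    (h : b.coord i p = 0) : p ∈ affineSpan k (b '' {j | j ≠ i}) := by
  rw [← b.affineCombination_coord_eq_self p]
  refine affineCombination_mem_affineSpan_image (b.sum_coord_apply_eq_one p) ?_ b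
  intro j _ hj
  have : j = i := by simpa using hj
  rw [this, h]

section

variable {V : Type*} [NormedAddCommGroup V] [InnerProductSpace ℝ V]

/-- An affine function that is nonnegative at `c` and has no zero in the open ball of radius `r`
around `c` satisfies `0 ≤ f c * ‖y‖ + r * f.linear y`, i.e. its homogenization is nonnegative on the
cone over that ball. -/
lemma AffineMap.mul_norm_add_mul_linear_nonneg (f : V →ᵃ[ℝ] ℝ) {c : V} {r : ℝ} (hr : 0 < r)
    (hc : 0 ≤ f c) (hf : ∀ x, f x = 0 → r ≤ dist c x) (y : V) :
    0 ≤ f c * ‖y‖ + r * f.linear y := by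
  by_contra! hneg
  have hlin (s : ℝ) : f (c + s • y) = f c + s * f.linear y := by
    rw [add_comm c, ← vadd_eq_add, f.map_vadd, map_smul, vadd_eq_add, smul_eq_mul, add_comm]
  have hl : f.linear y < 0 := by
    have := mul_nonneg hc (norm_nonneg y)
    by_contra! h
    nlinarith [mul_nonneg hr.le h]
  have h0 := hf (c + (f c / -f.linear y) • y) (by
    rw [hlin]; have := hl.ne; field_simp; ring)
  rw [dist_self_add_right, norm_smul, Real.norm_of_nonneg (div_nonneg hc (by linarith)),
    div_mul_eq_mul_div, le_div_iff₀ (by linarith)] at h0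
  linarith

/-- The composition of a Lorentz boost with the spatial reflection preserves the light cone. -/
lemma norm_boost_reflection {e v : V} {R a b : ℝ} (he : ‖e‖ = 1) (hv : ‖v‖ = R)
    (hab : a ^ 2 - b ^ 2 = 1) (ha : 0 ≤ a) :
    ‖-v - ((a - 1) * ⟪e, v⟫ + b * R) • e‖ = a * R + b * ⟪e, v⟫ := by
  have hR : 0 ≤ R := hv ▸ norm_nonneg v
  have hev : |⟪e, v⟫| ≤ R := by simpa [he, hv] using abs_real_inner_le_norm e v
  have hba : |b| ≤ a := abs_le_of_sq_le_sq (by linarith) ha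
  have hnonneg : 0 ≤ a * R + b * ⟪e, v⟫ := by
    have h1 : |b * ⟪e, v⟫| ≤ a * R := by
      rw [abs_mul]; exact mul_le_mul hba hev (abs_nonneg _) ha
    linarith [neg_abs_le (b * ⟪e, v⟫)]
  refine (sq_eq_sq₀ (norm_nonneg _) hnonneg).1 ?_
  rw [norm_sub_sq_real, norm_neg, norm_smul, he, hv, inner_neg_left, real_inner_smul_right,
    real_inner_comm e v, mul_one, Real.norm_eq_abs, sq_abs]
  linear_combination (R ^ 2 - ⟪e, v⟫ ^ 2) * (-hab)

lemma AffineMap.linear_apply_eq_sub (f : V →ᵃ[ℝ] ℝ) (x : V) : f.linear x = f x - f 0 := by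
  rw [← vsub_eq_sub (f x), ← f.linearMap_vsub, vsub_eq_sub, sub_zero]

variable {ι : Type*} [Fintype ι] (b : AffineBasis ι ℝ V)

lemma AffineBasis.sum_linear_coord (x : V) : ∑ i, (b.coord i).linear x = 0 := by
  simp_rw [AffineMap.linear_apply_eq_sub, Finset.sum_sub_distrib, b.sum_coord_apply_eq_one, sub_self]

lemma AffineBasis.sum_coord_smul_sub_s2 (x o : V) : ∑ i, b.coord i x • (b i - o) = x - o := by
  simp_rw [smul_sub, Finset.sum_sub_distrib, ← Finset.sum_smul, b.sum_coord_apply_eq_one, one_smul,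
    b.linear_combination_coord_eq_self]

lemma AffineBasis.sum_linear_coord_smul_sub (x o : V) :
    ∑ i, (b.coord i).linear x • (b i - o) = x := by
  simp_rw [AffineMap.linear_apply_eq_sub, sub_smul, Finset.sum_sub_distrib, b.sum_coord_smul_sub_s2]
  abel

lemma AffineBasis.sum_linear_coord_sub [FiniteDimensional ℝ V] (o : V) :
    ∑ i, (b.coord i).linear (b i - o) = Module.finrank ℝ V := by
  have h : ∑ i, ((b.coord i).linear.smulRight (b i - o)) = LinearMap.id := by
    ext x
    simpa using b.sum_linear_coord_smul_sub x o
  rw [← LinearMap.trace_id, ← h, map_sum]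
  simp

/-- The trace of the composition of a boosted reflection, mapping the circumscribed ball to the
inscribed ball, with the resolution of the identity by barycentric coordinates is nonnegative. -/
lemma AffineBasis.boost_trace_ineq [FiniteDimensional ℝ V] {o c e : V} {R r s t : ℝ} (hr : 0 < r)
    (hb : ∀ i, ‖b i - o‖ = R) (hc : ∀ i, 0 ≤ b.coord i c)
    (hdist : ∀ i x, b.coord i x = 0 → r ≤ dist c x) (he : ‖e‖ = 1) (hst : s ^ 2 - t ^ 2 = 1)
    (hs : 0 ≤ s) :
    r * (Module.finrank ℝ V + s - 1) ≤ s * R + t * ⟪e, c - o⟫ := by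
  have key (i : ι) : 0 ≤ b.coord i c * (s * R + t * ⟪e, b i - o⟫) +
      r * (b.coord i).linear (-(b i - o) - ((s - 1) * ⟪e, b i - o⟫ + t * R) • e) := by
    rw [← norm_boost_reflection he (hb i) hst hs]
    exact (b.coord i).mul_norm_add_mul_linear_nonneg hr (hc i) (hdist i) _
  have hsum := Finset.sum_nonneg fun i (_ : i ∈ Finset.univ) ↦ key i
  have h1 := b.sum_coord_apply_eq_one c
  have h2 : ∑ i, b.coord i c * ⟪e, b i - o⟫ = ⟪e, c - o⟫ := by
    rw [← b.sum_coord_smul_sub_s2 c o, inner_sum]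
    simp_rw [real_inner_smul_right]
  have h3 : ∑ i, (b.coord i).linear e * ⟪e, b i - o⟫ = 1 := by
    simp_rw [← real_inner_smul_right]
    rw [← inner_sum, b.sum_linear_coord_smul_sub, real_inner_self_eq_norm_sq, he, one_pow]
  have h4 := b.sum_linear_coord e
  have h5 := b.sum_linear_coord_sub o
  have hexp : ∑ i, (b.coord i c * (s * R + t * ⟪e, b i - o⟫) +
      r * (b.coord i).linear (-(b i - o) - ((s - 1) * ⟪e, b i - o⟫ + t * R) • e)) =
      s * R * ∑ i, b.coord i c + t * ∑ i, b.coord i c * ⟪e, b i - o⟫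
      - r * ∑ i, (b.coord i).linear (b i - o)
      - r * (s - 1) * ∑ i, (b.coord i).linear e * ⟪e, b i - o⟫
      - r * t * R * ∑ i, (b.coord i).linear e := by
    simp_rw [Finset.mul_sum, ← Finset.sum_add_distrib, ← Finset.sum_sub_distrib]
    refine Finset.sum_congr rfl fun i _ ↦ ?_
    rw [map_sub (b.coord i).linear (-(b i - o)), map_neg, map_smul, smul_eq_mul]
    ring
  rw [hexp, h1, h2, h3, h4, h5] at hsum
  linarith

end

lemma exists_norm_eq_one_inner_eq_norm {V : Type*} [NormedAddCommGroup V] [InnerProductSpace ℝ V]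
    [Nontrivial V] (v : V) : ∃ e : V, ‖e‖ = 1 ∧ ⟪e, v⟫ = ‖v‖ := by
  obtain rfl | hv := eq_or_ne v 0
  · obtain ⟨e, he⟩ := exists_norm_eq V zero_le_one
    exact ⟨e, he, by simp⟩
  · refine ⟨‖v‖⁻¹ • v, norm_smul_inv_norm hv, ?_⟩
    have := norm_ne_zero_iff.2 hv
    rw [real_inner_smul_left, real_inner_self_eq_norm_sq]
    field_simp

lemma sq_le_mul_of_forall_pos_two_mul_le {p q m : ℝ} (hm : 0 < m)
    (h : ∀ k : ℝ, 0 < k → 2 * m ≤ p * k + q / k) (hpq : p ≤ q) : m ^ 2 ≤ p * q := by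
  have hq : 0 < q := by linarith [h 1 one_pos]
  have hp : 0 < p := by
    by_contra! hp
    have h1 := h (q / m) (by positivity)
    rw [div_div_cancel₀ hq.ne'] at h1
    nlinarith [mul_nonneg (neg_nonneg.2 hp) (div_pos hq hm).le]
  have h1 := h (√(q / p)) (by positivity)
  have h2 : p * √(q / p) + q / √(q / p) = 2 * √(p * q) := by
    rw [Real.sqrt_div hq.le, Real.sqrt_mul hp.le]
    have hp' := Real.sq_sqrt hp.le
    have hq' := Real.sq_sqrt hq.le
    have := Real.sqrt_pos.2 hp
    have := Real.sqrt_pos.2 hq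
    field_simp
    rw [hp', hq']
    ring
  rw [h2] at h1
  exact (Real.le_sqrt hm.le (by positivity)).1 (by linarith)

/-- Egan conjecture: for a non-degenerate `n`-dimensional Euclidean simplex (`n ≥ 2`) with
circumradius `R`, inradius `r`, and distance `d` between circumcenter and incenter,
`(R - n r)(R + (n-2) r) ≥ d²`. -/
theorem egan_conjecture
    (n : ℕ) (hn : 2 ≤ n)
    (T : Affine.Simplex ℝ (EuclideanSpace ℝ (Fin n)) n)
    (I : EuclideanSpace ℝ (Fin n)) (r : ℝ) (hr : 0 < r)
    (hI : I ∈ convexHull ℝ (Set.range T.points))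
    (hdist : ∀ i : Fin (n + 1),
      Metric.infDist I (affineSpan ℝ (T.points '' {j | j ≠ i}) : Set (EuclideanSpace ℝ (Fin n))) = r) :
    (T.circumradius - n * r) * (T.circumradius + ((n : ℝ) - 2) * r) ≥ dist T.circumcenter I ^ 2 := by
  let b : AffineBasis (Fin (n + 1)) ℝ (EuclideanSpace ℝ (Fin n)) :=
    ⟨T.points, T.independent, T.independent.affineSpan_eq_top_iff_card_eq_finrank_add_one.2
      (by simp)⟩
  have hc (i : Fin (n + 1)) : 0 ≤ b.coord i I := by
    have hI' : I ∈ convexHull ℝ (Set.range b) := hI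
    rw [b.convexHull_eq_nonneg_coord] at hI'
    exact hI' i
  have hd (i : Fin (n + 1)) (x : EuclideanSpace ℝ (Fin n)) (hx : b.coord i x = 0) :
      r ≤ dist I x :=
    hdist i ▸ Metric.infDist_le_dist_of_mem (b.mem_affineSpan_image_ne_of_coord_eq_zero hx)
  have hb (i : Fin (n + 1)) : ‖b i - T.circumcenter‖ = T.circumradius := by
    rw [← dist_eq_norm]
    exact T.dist_circumcenter_eq_circumradius i
  have : Nontrivial (EuclideanSpace ℝ (Fin n)) :=
    Module.nontrivial_of_finrank_pos (R := ℝ) (by simp; omega)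
  obtain ⟨e, he, heI⟩ := exists_norm_eq_one_inner_eq_norm (I - T.circumcenter)
  rw [← dist_eq_norm, dist_comm] at heI
  have hn' : (2 : ℝ) ≤ n := by exact_mod_cast hn
  have hsq := sq_le_mul_of_forall_pos_two_mul_le (m := (n - 1) * r)
    (p := T.circumradius - r - dist T.circumcenter I)
    (q := T.circumradius - r + dist T.circumcenter I) (mul_pos (by linarith) hr) ?_
    (by linarith [dist_nonneg (x := T.circumcenter) (y := I)])
  · linarith
  intro k hk
  have h := b.boost_trace_ineq (s := (k + 1 / k) / 2) (t := (1 / k - k) / 2) hr hb hc hd he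
    (by field_simp; ring) (by positivity)
  rw [heI, finrank_euclideanSpace_fin] at h
  rw [div_eq_mul_one_div _ k]
  linarith
end

section
/- Let U and V be mutually polar spherical simplices in S^{n-1} (n >= 3), with circumradii β and γ and with circumcenters at spherical distance α. Set b = tan β, c = tan γ. Then sqrt((bc - 1)^2 cos^2 α - (b + c)^2 sin^2 α) >= n - 2, with equality when n = 3. -/
open RealInnerProductSpace Real

/-- The algebraic content of the spherical Chapple-Euler relation, in terms of the Gram entries
`g`, `k` of two polar triangles and the reciprocals `h` of the inner products of polar vertices. -/
lemma triangle_gram_identity (h₁ h₂ h₃ g₁₂ g₁₃ g₂₃ k₁₂ k₁₃ k₂₃ B C : ℝ)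
    (e₁₁ : h₁ * (h₁ + h₂ * g₁₂ * k₁₂ + h₃ * g₁₃ * k₁₃) = 1)
    (e₂₂ : h₂ * (h₁ * g₁₂ * k₁₂ + h₂ + h₃ * g₂₃ * k₂₃) = 1)
    (e₃₃ : h₃ * (h₁ * g₁₃ * k₁₃ + h₂ * g₂₃ * k₂₃ + h₃) = 1)
    (e₁₂ : h₁ * k₁₂ + h₂ * g₁₂ + h₃ * g₁₃ * k₂₃ = 0)
    (e₁₃ : h₁ * k₁₃ + h₂ * g₁₂ * k₂₃ + h₃ * g₁₃ = 0)
    (e₂₁ : h₁ * g₁₂ + h₂ * k₁₂ + h₃ * g₂₃ * k₁₃ = 0)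
    (e₂₃ : h₁ * g₁₂ * k₁₃ + h₂ * k₂₃ + h₃ * g₂₃ = 0)
    (e₃₁ : h₁ * g₁₃ + h₂ * g₂₃ * k₁₂ + h₃ * k₁₃ = 0)
    (e₃₂ : h₁ * g₁₃ * k₁₂ + h₂ * g₂₃ + h₃ * k₂₃ = 0)
    (hC : 1 + C = h₁ ^ 2 + h₂ ^ 2 + h₃ ^ 2
      + 2 * (h₁ * h₂ * g₁₂ + h₁ * h₃ * g₁₃ + h₂ * h₃ * g₂₃))
    (hB : 1 + B = h₁ ^ 2 + h₂ ^ 2 + h₃ ^ 2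
      + 2 * (h₁ * h₂ * k₁₂ + h₁ * h₃ * k₁₃ + h₂ * h₃ * k₂₃)) :
    ((h₁ + h₂ + h₃) ^ 2 - 1 - B - C) ^ 2 = 4 * (B * C) := by
  obtain ⟨Δ, hΔ⟩ : ∃ Δ, Δ = 1 + 2 * g₁₂ * g₁₃ * g₂₃ - g₁₂ ^ 2 - g₁₃ ^ 2 - g₂₃ ^ 2 := ⟨_, rfl⟩
  have a₁₁ : Δ * h₁ ^ 2 = 1 - g₂₃ ^ 2 := by
    linear_combination h₁ ^ 2 * hΔ + (1 - g₂₃ ^ 2) * e₁₁ + h₁ * (g₁₃ * g₂₃ - g₁₂) * e₂₁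
      + h₁ * (g₁₂ * g₂₃ - g₁₃) * e₃₁
  have a₂₂ : Δ * h₂ ^ 2 = 1 - g₁₃ ^ 2 := by
    linear_combination h₂ ^ 2 * hΔ + (1 - g₁₃ ^ 2) * e₂₂ + h₂ * (g₁₃ * g₂₃ - g₁₂) * e₁₂
      + h₂ * (g₁₂ * g₁₃ - g₂₃) * e₃₂
  have a₃₃ : Δ * h₃ ^ 2 = 1 - g₁₂ ^ 2 := by
    linear_combination h₃ ^ 2 * hΔ + (1 - g₁₂ ^ 2) * e₃₃ + h₃ * (g₁₂ * g₂₃ - g₁₃) * e₁₃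
      + h₃ * (g₁₂ * g₁₃ - g₂₃) * e₂₃
  have a₁₂ : Δ * (h₁ * h₂ * k₁₂) = g₁₃ * g₂₃ - g₁₂ := by
    linear_combination h₁ * h₂ * k₁₂ * hΔ + h₂ * (1 - g₂₃ ^ 2) * e₁₂ + (g₁₃ * g₂₃ - g₁₂) * e₂₂
      + h₂ * (g₁₂ * g₂₃ - g₁₃) * e₃₂
  have a₁₃ : Δ * (h₁ * h₃ * k₁₃) = g₁₂ * g₂₃ - g₁₃ := by
    linear_combination h₁ * h₃ * k₁₃ * hΔ + h₃ * (1 - g₂₃ ^ 2) * e₁₃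
      + h₃ * (g₁₃ * g₂₃ - g₁₂) * e₂₃ + (g₁₂ * g₂₃ - g₁₃) * e₃₃
  have a₂₃ : Δ * (h₂ * h₃ * k₂₃) = g₁₂ * g₁₃ - g₂₃ := by
    linear_combination h₂ * h₃ * k₂₃ * hΔ + h₃ * (g₁₃ * g₂₃ - g₁₂) * e₁₃
      + h₃ * (1 - g₁₃ ^ 2) * e₂₃ + (g₁₂ * g₁₃ - g₂₃) * e₃₃
  obtain ⟨Γ, hΓ⟩ : ∃ Γ, Γ = h₁ ^ 2 * h₂ ^ 2 * h₃ ^ 2 *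
    (1 + 2 * k₁₂ * k₁₃ * k₂₃ - k₁₂ ^ 2 - k₁₃ ^ 2 - k₂₃ ^ 2) := ⟨_, rfl⟩
  -- the inverse of the Gram matrix has the reciprocal determinant
  have hΔΓ : Δ * Γ = 1 := by
    have hmul : !![1, g₁₂, g₁₃; g₁₂, 1, g₂₃; g₁₃, g₂₃, 1] *
        !![h₁ ^ 2, h₁ * h₂ * k₁₂, h₁ * h₃ * k₁₃; h₁ * h₂ * k₁₂, h₂ ^ 2, h₂ * h₃ * k₂₃;
          h₁ * h₃ * k₁₃, h₂ * h₃ * k₂₃, h₃ ^ 2] = (1 : Matrix (Fin 3) (Fin 3) ℝ) := by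
      ext i j
      fin_cases i <;> fin_cases j <;> simp [Matrix.mul_apply, Fin.sum_univ_three]
      · linear_combination e₁₁
      · linear_combination h₂ * e₁₂
      · linear_combination h₃ * e₁₃
      · linear_combination h₁ * e₂₁
      · linear_combination e₂₂
      · linear_combination h₃ * e₂₃
      · linear_combination h₁ * e₃₁
      · linear_combination h₂ * e₃₂
      · linear_combination e₃₃
    have hd := congrArg Matrix.det hmul
    rw [Matrix.det_mul, Matrix.det_one, Matrix.det_fin_three, Matrix.det_fin_three] at hd
    simp at hd
    rw [hΔ, hΓ]
    linear_combination hd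
  have hM : 2 * ((g₁₂ - 1) * (g₁₃ - 1) * (g₂₃ - 1)) = -(B * Δ) := by
    linear_combination Δ * hB - hΔ + a₁₁ + a₂₂ + a₃₃ + 2 * a₁₂ + 2 * a₁₃ + 2 * a₂₃
  have hN : 2 * (h₁ ^ 2 * h₂ ^ 2 * h₃ ^ 2 * ((k₁₂ - 1) * (k₁₃ - 1) * (k₂₃ - 1))) = -(C * Γ) := by
    have b₁₂ : h₁ * h₂ * h₃ ^ 2 * (k₁₃ * k₂₃ - k₁₂) = Γ * g₁₂ := by
      linear_combination -(h₁ * h₂ * h₃ ^ 2 * (k₁₃ * k₂₃ - k₁₂)) * e₁₁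
        - (h₁ ^ 2 * h₃ ^ 2 * (1 - k₁₃ ^ 2)) * (h₂ * e₁₂)
        - (h₂ * h₃ * h₁ ^ 2 * (k₁₃ * k₁₂ - k₂₃)) * (h₃ * e₁₃)
        - g₁₂ * hΓ
    have b₁₃ : h₁ * h₃ * h₂ ^ 2 * (k₁₂ * k₂₃ - k₁₃) = Γ * g₁₃ := by
      linear_combination -(h₁ * h₃ * h₂ ^ 2 * (k₁₂ * k₂₃ - k₁₃)) * e₁₁
        - (h₂ * h₃ * h₁ ^ 2 * (k₁₂ * k₁₃ - k₂₃)) * (h₂ * e₁₂)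
        - (h₁ ^ 2 * h₂ ^ 2 * (1 - k₁₂ ^ 2)) * (h₃ * e₁₃)
        - g₁₃ * hΓ
    have b₂₃ : h₂ * h₃ * h₁ ^ 2 * (k₁₂ * k₁₃ - k₂₃) = Γ * g₂₃ := by
      linear_combination -(h₁ * h₃ * h₂ ^ 2 * (k₁₂ * k₂₃ - k₁₃)) * (h₁ * e₂₁)
        - (h₂ * h₃ * h₁ ^ 2 * (k₁₂ * k₁₃ - k₂₃)) * e₂₂
        - (h₁ ^ 2 * h₂ ^ 2 * (1 - k₁₂ ^ 2)) * (h₃ * e₂₃)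
        - g₂₃ * hΓ
    have b₁₁ : h₂ ^ 2 * h₃ ^ 2 * (1 - k₂₃ ^ 2) = Γ := by
      linear_combination -(h₂ ^ 2 * h₃ ^ 2 * (1 - k₂₃ ^ 2)) * e₁₁
        - (h₁ * h₂ * h₃ ^ 2 * (k₂₃ * k₁₃ - k₁₂)) * (h₂ * e₁₂)
        - (h₁ * h₃ * h₂ ^ 2 * (k₂₃ * k₁₂ - k₁₃)) * (h₃ * e₁₃)
        - hΓ
    have b₂₂ : h₁ ^ 2 * h₃ ^ 2 * (1 - k₁₃ ^ 2) = Γ := by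
      linear_combination -(h₁ * h₂ * h₃ ^ 2 * (k₁₃ * k₂₃ - k₁₂)) * (h₁ * e₂₁)
        - (h₁ ^ 2 * h₃ ^ 2 * (1 - k₁₃ ^ 2)) * e₂₂
        - (h₂ * h₃ * h₁ ^ 2 * (k₁₃ * k₁₂ - k₂₃)) * (h₃ * e₂₃)
        - hΓ
    have b₃₃ : h₁ ^ 2 * h₂ ^ 2 * (1 - k₁₂ ^ 2) = Γ := by
      linear_combination -(h₁ * h₃ * h₂ ^ 2 * (k₁₂ * k₂₃ - k₁₃)) * (h₁ * e₃₁)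
        - (h₂ * h₃ * h₁ ^ 2 * (k₁₂ * k₁₃ - k₂₃)) * (h₂ * e₃₂)
        - (h₁ ^ 2 * h₂ ^ 2 * (1 - k₁₂ ^ 2)) * e₃₃
        - hΓ
    linear_combination Γ * hC - hΓ - h₁ ^ 2 * b₁₁ - h₂ ^ 2 * b₂₂ - h₃ ^ 2 * b₃₃
      - 2 * h₁ * h₂ * b₁₂ - 2 * h₁ * h₃ * b₁₃ - 2 * h₂ * h₃ * b₂₃
  obtain ⟨x, hx⟩ : ∃ x, x = h₁ * h₂ * ((g₁₂ - 1) * (k₁₂ - 1)) := ⟨_, rfl⟩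
  obtain ⟨y, hy⟩ : ∃ y, y = h₁ * h₃ * ((g₁₃ - 1) * (k₁₃ - 1)) := ⟨_, rfl⟩
  obtain ⟨z, hz⟩ : ∃ z, z = h₂ * h₃ * ((g₂₃ - 1) * (k₂₃ - 1)) := ⟨_, rfl⟩
  have htr : 2 * (x + y + z) = 1 - B - C + (h₁ + h₂ + h₃) ^ 2 := by
    rw [hx, hy, hz]; linear_combination e₁₁ + e₂₂ + e₃₃ + hB + hC
  have hdet : 4 * (x * y * z) = B * C := by
    rw [hx, hy, hz]
    linear_combination 2 * (h₁ ^ 2 * h₂ ^ 2 * h₃ ^ 2 * ((k₁₂ - 1) * (k₁₃ - 1) * (k₂₃ - 1))) * hM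
      - B * Δ * hN + B * C * hΔΓ
  have hone : (1 - (x + y + z)) ^ 2 = 4 * (x * y * z) := by
    -- `M * N - 1` is a sum of two rank-one matrices
    have r₁₁ : (g₁₂ - 1) * (h₂ * h₁ * (k₁₂ - 1)) + (g₁₃ - 1) * (h₃ * h₁ * (k₁₃ - 1)) - 1
        = ((h₁ + h₂ + h₃) - (h₁ + g₁₂ * h₂ + g₁₃ * h₃)) * h₁
          - (h₁ ^ 2 + h₂ * h₁ * k₁₂ + h₃ * h₁ * k₁₃) := by
      linear_combination e₁₁
    have r₁₂ : (g₁₃ - 1) * (h₃ * h₂ * (k₂₃ - 1))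
        = ((h₁ + h₂ + h₃) - (h₁ + g₁₂ * h₂ + g₁₃ * h₃)) * h₂
          - (h₁ * h₂ * k₁₂ + h₂ ^ 2 + h₃ * h₂ * k₂₃) := by
      linear_combination h₂ * e₁₂
    have r₁₃ : (g₁₂ - 1) * (h₂ * h₃ * (k₂₃ - 1))
        = ((h₁ + h₂ + h₃) - (h₁ + g₁₂ * h₂ + g₁₃ * h₃)) * h₃
          - (h₁ * h₃ * k₁₃ + h₂ * h₃ * k₂₃ + h₃ ^ 2) := by
      linear_combination h₃ * e₁₃
    have r₂₁ : (g₂₃ - 1) * (h₃ * h₁ * (k₁₃ - 1))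
        = ((h₁ + h₂ + h₃) - (g₁₂ * h₁ + h₂ + g₂₃ * h₃)) * h₁
          - (h₁ ^ 2 + h₂ * h₁ * k₁₂ + h₃ * h₁ * k₁₃) := by
      linear_combination h₁ * e₂₁
    have r₂₂ : (g₁₂ - 1) * (h₁ * h₂ * (k₁₂ - 1)) + (g₂₃ - 1) * (h₃ * h₂ * (k₂₃ - 1)) - 1
        = ((h₁ + h₂ + h₃) - (g₁₂ * h₁ + h₂ + g₂₃ * h₃)) * h₂
          - (h₁ * h₂ * k₁₂ + h₂ ^ 2 + h₃ * h₂ * k₂₃) := by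
      linear_combination e₂₂
    have r₂₃ : (g₁₂ - 1) * (h₁ * h₃ * (k₁₃ - 1))
        = ((h₁ + h₂ + h₃) - (g₁₂ * h₁ + h₂ + g₂₃ * h₃)) * h₃
          - (h₁ * h₃ * k₁₃ + h₂ * h₃ * k₂₃ + h₃ ^ 2) := by
      linear_combination h₃ * e₂₃
    have r₃₁ : (g₂₃ - 1) * (h₂ * h₁ * (k₁₂ - 1))
        = ((h₁ + h₂ + h₃) - (g₁₃ * h₁ + g₂₃ * h₂ + h₃)) * h₁
          - (h₁ ^ 2 + h₂ * h₁ * k₁₂ + h₃ * h₁ * k₁₃) := by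
      linear_combination h₁ * e₃₁
    have r₃₂ : (g₁₃ - 1) * (h₁ * h₂ * (k₁₂ - 1))
        = ((h₁ + h₂ + h₃) - (g₁₃ * h₁ + g₂₃ * h₂ + h₃)) * h₂
          - (h₁ * h₂ * k₁₂ + h₂ ^ 2 + h₃ * h₂ * k₂₃) := by
      linear_combination h₂ * e₃₂
    have r₃₃ : (g₁₃ - 1) * (h₁ * h₃ * (k₁₃ - 1)) + (g₂₃ - 1) * (h₂ * h₃ * (k₂₃ - 1)) - 1
        = ((h₁ + h₂ + h₃) - (g₁₃ * h₁ + g₂₃ * h₂ + h₃)) * h₃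
          - (h₁ * h₃ * k₁₃ + h₂ * h₃ * k₂₃ + h₃ ^ 2) := by
      linear_combination e₃₃
    have hdet0 : ((g₁₂ - 1) * (h₂ * h₁ * (k₁₂ - 1)) + (g₁₃ - 1) * (h₃ * h₁ * (k₁₃ - 1)) - 1) * ((g₁₂ - 1) * (h₁ * h₂ * (k₁₂ - 1)) + (g₂₃ - 1) * (h₃ * h₂ * (k₂₃ - 1)) - 1)
          * ((g₁₃ - 1) * (h₁ * h₃ * (k₁₃ - 1)) + (g₂₃ - 1) * (h₂ * h₃ * (k₂₃ - 1)) - 1)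
        - ((g₁₂ - 1) * (h₂ * h₁ * (k₁₂ - 1)) + (g₁₃ - 1) * (h₃ * h₁ * (k₁₃ - 1)) - 1) * ((g₁₂ - 1) * (h₁ * h₃ * (k₁₃ - 1)))
          * ((g₁₃ - 1) * (h₁ * h₂ * (k₁₂ - 1)))
        - ((g₁₃ - 1) * (h₃ * h₂ * (k₂₃ - 1))) * ((g₂₃ - 1) * (h₃ * h₁ * (k₁₃ - 1)))
          * ((g₁₃ - 1) * (h₁ * h₃ * (k₁₃ - 1)) + (g₂₃ - 1) * (h₂ * h₃ * (k₂₃ - 1)) - 1)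
        + ((g₁₃ - 1) * (h₃ * h₂ * (k₂₃ - 1))) * ((g₁₂ - 1) * (h₁ * h₃ * (k₁₃ - 1)))
          * ((g₂₃ - 1) * (h₂ * h₁ * (k₁₂ - 1)))
        + ((g₁₂ - 1) * (h₂ * h₃ * (k₂₃ - 1))) * ((g₂₃ - 1) * (h₃ * h₁ * (k₁₃ - 1)))
          * ((g₁₃ - 1) * (h₁ * h₂ * (k₁₂ - 1)))
        - ((g₁₂ - 1) * (h₂ * h₃ * (k₂₃ - 1))) * ((g₁₂ - 1) * (h₁ * h₂ * (k₁₂ - 1)) + (g₂₃ - 1) * (h₃ * h₂ * (k₂₃ - 1)) - 1)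
          * ((g₂₃ - 1) * (h₂ * h₁ * (k₁₂ - 1))) = 0 := by
      rw [r₁₁, r₁₂, r₁₃, r₂₁, r₂₂, r₂₃, r₃₁, r₃₂, r₃₃]
      ring
    rw [hx, hy, hz]
    linear_combination -hdet0
  linear_combination 4 * hone + 4 * hdet + (2 - 2 * (x+y+z) + 1 + B + C - (h₁ + h₂ + h₃) ^ 2) * htr

/-- The reciprocals of the inner products of polar vertices expand the inner product. -/
lemma polar_inner_expansion {n : ℕ} (u v : Fin n → EuclideanSpace ℝ (Fin n))
    (hv_li : LinearIndependent ℝ v) (hpolar : ∀ i j, i ≠ j → ⟪u i, v j⟫ = 0)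
    (hpos : ∀ i, 0 < ⟪u i, v i⟫) (x y : EuclideanSpace ℝ (Fin n)) :
    ⟪x, y⟫ = ∑ i, ⟪u i, v i⟫⁻¹ * (⟪x, u i⟫ * ⟪y, v i⟫) := by
  have hspan : Submodule.span ℝ (Set.range v) = ⊤ :=
    hv_li.span_eq_top_of_card_eq_finrank' (by simp)
  have hzero : y - ∑ i, (⟪u i, v i⟫⁻¹ * ⟪y, v i⟫) • u i = 0 := by
    refine (Submodule.mem_bot ℝ).1 ?_
    rw [← Submodule.top_orthogonal_eq_bot, ← hspan, Submodule.mem_orthogonal]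
    intro w hw
    induction hw using Submodule.span_induction with
    | mem w hw =>
      obtain ⟨j, rfl⟩ := hw
      rw [inner_sub_right, inner_sum, Finset.sum_eq_single j]
      · rw [inner_smul_right, real_inner_comm (u j), real_inner_comm (v j) y]
        have := (hpos j).ne'
        field_simp
        ring
      · intro i _ hij
        rw [inner_smul_right, real_inner_comm (u i), hpolar i j hij, mul_zero]
      · simp
    | zero => simp
    | add a b _ _ ha hb => rw [inner_add_left, ha, hb, add_zero]
    | smul r a _ ha => rw [inner_smul_left, ha, mul_zero]
  conv_lhs => rw [sub_eq_zero.1 hzero]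
  rw [inner_sum]
  refine Finset.sum_congr rfl fun i _ => ?_
  rw [inner_smul_right]
  ring

/-- Two vectors of a space of dimension at least two, the first of them nonzero, lie in the span of
an orthonormal pair starting in the direction of the first. -/
lemma exists_orthonormal_pair_of_pair {E : Type*} [NormedAddCommGroup E] [InnerProductSpace ℝ E]
    [FiniteDimensional ℝ E] (hE : 2 ≤ Module.finrank ℝ E) (p : E) {q : E} (hq : q ≠ 0) :
    ∃ (e f : E) (s t : ℝ), ‖e‖ = 1 ∧ ‖f‖ = 1 ∧ ⟪e, f⟫ = 0 ∧ q = ‖q‖ • e ∧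
      p = s • e + t • f ∧ 0 ≤ t := by
  have hq' : ‖q‖ ≠ 0 := norm_ne_zero_iff.2 hq
  obtain ⟨e, he⟩ : ∃ e, e = ‖q‖⁻¹ • q := ⟨_, rfl⟩
  have he1 : ‖e‖ = 1 := by rw [he, norm_smul, norm_inv, norm_norm, inv_mul_cancel₀ hq']
  have hqe : q = ‖q‖ • e := by rw [he, smul_smul, mul_inv_cancel₀ hq', one_smul]
  by_cases h : p - ⟪e, p⟫ • e = 0
  · obtain ⟨w, hw, hw0⟩ := (Submodule.ne_bot_iff _).1 (LinearMap.ker_ne_bot_of_finrank_lt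
      (f := (innerSL ℝ e : E →ₗ[ℝ] ℝ)) (by rw [Module.finrank_self]; omega))
    have hw' : ⟪e, w⟫ = 0 := by simpa using hw
    refine ⟨e, ‖w‖⁻¹ • w, ⟪e, p⟫, 0, he1, ?_, ?_, hqe, ?_, le_rfl⟩
    · rw [norm_smul, norm_inv, norm_norm, inv_mul_cancel₀ (norm_ne_zero_iff.2 hw0)]
    · rw [inner_smul_right, hw', mul_zero]
    · rw [zero_smul, add_zero]; exact sub_eq_zero.1 h
  · have hr : ‖p - ⟪e, p⟫ • e‖ ≠ 0 := norm_ne_zero_iff.2 h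
    refine ⟨e, ‖p - ⟪e, p⟫ • e‖⁻¹ • (p - ⟪e, p⟫ • e), ⟪e, p⟫, ‖p - ⟪e, p⟫ • e‖, he1, ?_, ?_, hqe,
      ?_, norm_nonneg _⟩
    · rw [norm_smul, norm_inv, norm_norm, inv_mul_cancel₀ hr]
    · rw [inner_smul_right, inner_sub_right, inner_smul_right, real_inner_self_eq_norm_sq, he1]
      ring
    · rw [smul_smul, mul_inv_cancel₀ hr, one_smul]; abel

/-- Scalar consequences of the insphere lying strictly inside the circumsphere. -/
lemma tan_bounds_of_insphere_lt {b c S R : ℝ} (hb : 0 ≤ b) (hc : 0 ≤ c) (hR0 : 0 ≤ R)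
    (hRsq : R ^ 2 = (1 + b ^ 2) * (1 + c ^ 2) - S ^ 2)
    (hlt : c * (1 + c ^ 2 + R) < c * (c * S)) : 0 < c ∧ b + c < S ∧ 1 ≤ b * c := by
  have hc0 : 0 < c := by
    rcases hc.lt_or_eq with h | rfl
    · exact h
    · simp at hlt
  have hlt' : 1 + c ^ 2 + R < c * S := lt_of_mul_lt_mul_left hlt hc
  have hS0 : 0 < S := pos_of_mul_pos_right (by nlinarith : 0 < c * S) hc
  have hbcS : b + c < S := by
    by_contra! hle
    have h1 : b * c - 1 ≤ R := by
      refine le_of_abs_le (abs_le_of_sq_le_sq ?_ hR0)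
      rw [hRsq]; nlinarith
    have h2 := mul_le_mul_of_nonneg_left hle hc
    linarith
  have hbc : 1 ≤ b * c := by
    by_contra! hbc1
    have h1 : c ^ 2 * S ^ 2 ≤ (1 + c ^ 2) ^ 2 := by
      have : (b * c) ^ 2 < 1 := by nlinarith [mul_nonneg hb hc]
      nlinarith [sq_nonneg R, sq_nonneg c]
    nlinarith
  exact ⟨hc0, hbcS, hbc⟩

/-- A bound on `w` extracted from a quadratic one. -/
lemma mul_le_mul_of_sq_le {b c S σ w : ℝ} (hb : 0 ≤ b) (hS0 : 0 < S) (hbc : 1 ≤ b * c)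
    (hσ : σ ^ 2 = S ^ 2 - (b + c) ^ 2)
    (hw : ((1 + b ^ 2) * w - S) ^ 2 ≤ b ^ 2 * ((1 + b ^ 2) * (1 + c ^ 2) - S ^ 2)) :
    (b + c) * w ≤ c * S := by
  by_contra! hlt
  have hlt' : S * b * (b * c - 1) < (b + c) * ((1 + b ^ 2) * w - S) := by
    nlinarith [mul_pos (sub_pos.2 hlt) (by positivity : 0 < 1 + b ^ 2)]
  have h₁ : 0 ≤ S * b * (b * c - 1) := by
    have := sub_nonneg.2 hbc
    positivity
  have h₂ := pow_lt_pow_left₀ hlt' h₁ two_ne_zero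
  have h₃ := mul_le_mul_of_nonneg_left hw (sq_nonneg (b + c))
  have h₄ : 0 ≤ (b * σ) ^ 2 * ((b * c - 1) ^ 2 + (b + c) ^ 2) := by positivity
  have h₅ : S ^ 2 = σ ^ 2 + (b + c) ^ 2 := by linarith
  rw [mul_pow, mul_pow, mul_pow, h₅] at h₂
  rw [h₅] at h₃
  linarith

section Polar

variable {E : Type*} [NormedAddCommGroup E] [InnerProductSpace ℝ E] {n : ℕ} {u v : Fin n → E}
  {h : Fin n → ℝ} {p q : E} {b c : ℝ}

/-- The insphere of a spherical simplex lies strictly inside its circumsphere, tested at a point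
`z` of the sphere circumscribed about the polar simplex. -/
lemma circumradius_add_inner_lt (hn : 3 ≤ n) (hu : ∀ i, ‖u i‖ = 1) (hv : ∀ i, ‖v i‖ = 1)
    (hv_inj : Function.Injective v) (hpolar : ∀ i j, i ≠ j → ⟪u i, v j⟫ = 0) (hh : ∀ i, 0 < h i)
    (hexp : ∀ x y : E, ⟪x, y⟫ = ∑ i, h i * (⟪x, u i⟫ * ⟪y, v i⟫))
    (hp : ∀ i, ⟪u i, p⟫ = 1) (hq : ∀ i, ⟪v i, q⟫ = 1) (hc : 0 ≤ c) (hqc : ‖q‖ ^ 2 = 1 + c ^ 2)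
    {z : E} (hz : ‖z‖ = 1) (hzq : ⟪z, q⟫ = 1) : c + ⟪z, p⟫ < ⟪p, q⟫ := by
  by_contra! hle
  obtain ⟨x, hx⟩ : ∃ x, x = q - z := ⟨_, rfl⟩
  have hxv : ∀ i, ⟪x, v i⟫ = 1 - ⟪z, v i⟫ := fun i => by
    rw [hx, inner_sub_left, real_inner_comm, hq]
  have hxx : ⟪x, x⟫ = c ^ 2 := by
    rw [real_inner_self_eq_norm_sq, hx, norm_sub_sq_real, hqc, real_inner_comm, hzq, hz]; ring
  have hxn : ‖x‖ = c := by
    rw [real_inner_self_eq_norm_sq] at hxx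
    exact (sq_eq_sq₀ (norm_nonneg _) hc).1 hxx
  have hxp : ⟪p, x⟫ ≤ c := by
    rw [hx, inner_sub_right, real_inner_comm z p]; linarith
  have hxv0 : ∀ i, 0 ≤ ⟪x, v i⟫ := fun i => by
    have := real_inner_le_norm z (v i)
    rw [hz, hv] at this
    rw [hxv]; linarith
  have hxu0 : ∀ i, 0 ≤ c - ⟪x, u i⟫ := fun i => by
    have := real_inner_le_norm x (u i)
    rw [hxn, hu] at this
    linarith
  have hsum : ∑ i, h i * ((c - ⟪x, u i⟫) * ⟪x, v i⟫) = c * ⟪p, x⟫ - ⟪x, x⟫ := by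
    rw [hexp p x, hexp x x, Finset.mul_sum, ← Finset.sum_sub_distrib]
    refine Finset.sum_congr rfl fun i _ => ?_
    rw [real_inner_comm (u i) p, hp]; ring
  have hterm0 : ∀ i, 0 ≤ h i * ((c - ⟪x, u i⟫) * ⟪x, v i⟫) := fun i =>
    mul_nonneg (hh i).le (mul_nonneg (hxu0 i) (hxv0 i))
  have hterm : ∀ i, h i * ((c - ⟪x, u i⟫) * ⟪x, v i⟫) = 0 := by
    have h0 : ∑ i, h i * ((c - ⟪x, u i⟫) * ⟪x, v i⟫) = 0 := by
      refine le_antisymm ?_ (Finset.sum_nonneg fun i _ => hterm0 i)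
      rw [hsum, hxx]; nlinarith
    exact fun i => (Finset.sum_eq_zero_iff_of_nonneg fun i _ => hterm0 i).1 h0 i (Finset.mem_univ i)
  have hpar : ∀ i, ⟪x, v i⟫ ≠ 0 → x = c • u i := fun i hi => by
    have hxu : c - ⟪x, u i⟫ = 0 := by
      have := hterm i
      simpa [(hh i).ne', hi] using this
    have : ‖x - c • u i‖ ^ 2 = 0 := by
      rw [norm_sub_sq_real, hxn, inner_smul_right, norm_smul, hu, Real.norm_eq_abs, mul_one, sq_abs]
      linear_combination 2 * c * hxu
    exact sub_eq_zero.1 (norm_eq_zero.1 (pow_eq_zero_iff two_ne_zero |>.1 this))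
  have hoff : ∀ i j, i ≠ j → ⟪x, v i⟫ ≠ 0 → ⟪x, v j⟫ = 0 := fun i j hij hi => by
    rw [hpar i hi, inner_smul_left, hpolar i j hij, mul_zero]
  have hvz : ∀ i, ⟪x, v i⟫ = 0 → v i = z := fun i hi => by
    rw [hxv] at hi
    have : ‖v i - z‖ ^ 2 = 0 := by
      rw [norm_sub_sq_real, hv, hz, real_inner_comm]; linarith
    exact sub_eq_zero.1 (norm_eq_zero.1 (pow_eq_zero_iff two_ne_zero |>.1 this))
  obtain ⟨j, k, hjk, hj, hk⟩ : ∃ j k, j ≠ k ∧ ⟪x, v j⟫ = 0 ∧ ⟪x, v k⟫ = 0 := by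
    have h01 : (⟨0, by omega⟩ : Fin n) ≠ ⟨1, by omega⟩ := by simp
    have h02 : (⟨0, by omega⟩ : Fin n) ≠ ⟨2, by omega⟩ := by simp
    have h12 : (⟨1, by omega⟩ : Fin n) ≠ ⟨2, by omega⟩ := by simp
    by_cases h0 : ⟪x, v ⟨0, by omega⟩⟫ = 0
    · by_cases h1 : ⟪x, v ⟨1, by omega⟩⟫ = 0
      · exact ⟨_, _, h01, h0, h1⟩
      · exact ⟨_, _, h02, h0, hoff _ _ h12 h1⟩
    · exact ⟨_, _, h12, hoff _ _ h01 h0, hoff _ _ h02 h0⟩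
  exact hjk (hv_inj ((hvz j hj).trans (hvz k hk).symm))

/-- The bound for `n` in terms of the inner product of the scaled circumcenters. -/
lemma polar_simplices_bound [FiniteDimensional ℝ E] (hE : 2 ≤ Module.finrank ℝ E)
    (hn : 3 ≤ n) (hu : ∀ i, ‖u i‖ = 1) (hv : ∀ i, ‖v i‖ = 1)
    (hv_inj : Function.Injective v) (hpolar : ∀ i j, i ≠ j → ⟪u i, v j⟫ = 0) (hh : ∀ i, 0 < h i)
    (hdiag : ∀ i, h i * ⟪u i, v i⟫ = 1)
    (hexp : ∀ x y : E, ⟪x, y⟫ = ∑ i, h i * (⟪x, u i⟫ * ⟪y, v i⟫))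
    (hp : ∀ i, ⟪u i, p⟫ = 1) (hq : ∀ i, ⟪v i, q⟫ = 1) (hb : 0 ≤ b) (hc : 0 ≤ c)
    (hpb : ‖p‖ ^ 2 = 1 + b ^ 2) (hqc : ‖q‖ ^ 2 = 1 + c ^ 2) :
    (n : ℝ) - 2 ≤ √(⟪p, q⟫ ^ 2 - (b + c) ^ 2) := by
  have hS : ⟪p, q⟫ = ∑ i, h i := by
    rw [hexp]
    refine Finset.sum_congr rfl fun i _ => ?_
    rw [real_inner_comm, hp, real_inner_comm, hq]; ring
  have hS0 : 0 < ⟪p, q⟫ := by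
    rw [hS]; exact Finset.sum_pos (fun i _ => hh i) ⟨⟨0, by omega⟩, Finset.mem_univ _⟩
  have hq0 : q ≠ 0 := by
    rintro rfl; simp at hS0
  obtain ⟨e, f, p₁, p₂, he, hf, hef, hqe, hpe, hp₂⟩ := exists_orthonormal_pair_of_pair hE p hq0
  obtain ⟨Q, hQ⟩ : ∃ Q, Q = ‖q‖ := ⟨_, rfl⟩
  have hQ0 : 0 < Q := by rw [hQ]; exact norm_pos_iff.2 hq0
  rw [← hQ] at hqe hqc
  have hee : ⟪e, e⟫ = 1 := by rw [real_inner_self_eq_norm_sq, he, one_pow]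
  have hff : ⟪f, f⟫ = 1 := by rw [real_inner_self_eq_norm_sq, hf, one_pow]
  have hfe : ⟪f, e⟫ = 0 := by rw [real_inner_comm, hef]
  obtain ⟨S, hSdef⟩ : ∃ S, S = ⟪p, q⟫ := ⟨_, rfl⟩
  rw [← hSdef] at hS hS0 ⊢
  have hSp : S = Q * p₁ := by
    rw [hSdef, hpe, hqe]
    simp [inner_add_left, inner_smul_left, inner_smul_right, he, hfe]
  have hpp : p₁ ^ 2 + p₂ ^ 2 = 1 + b ^ 2 := by
    rw [← hpb, ← real_inner_self_eq_norm_sq, hpe]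
    simp only [inner_add_left, inner_add_right, inner_smul_left, inner_smul_right, hee, hfe, hff,
      hef]
    simp; ring
  have hzlt : c * (1 + c ^ 2 + Q * p₂) < c * (c * S) := by
    have hlt := circumradius_add_inner_lt hn hu hv hv_inj hpolar hh hexp hp hq hc
      (by rw [← hQ]; exact hqc) (z := Q⁻¹ • (e + c • f)) ?_ ?_
    · have : ⟪Q⁻¹ • (e + c • f), p⟫ = Q⁻¹ * (p₁ + c * p₂) := by
        rw [hpe]
        simp only [inner_add_left, inner_add_right, inner_smul_left, inner_smul_right, hee, hfe,
          hff, hef]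
        simp; ring
      rw [this, ← hSdef] at hlt
      have h2 := mul_lt_mul_of_pos_left hlt (pow_pos hQ0 2)
      have h3 : Q ^ 2 * (c + Q⁻¹ * (p₁ + c * p₂)) = Q ^ 2 * c + Q * (p₁ + c * p₂) := by
        field_simp
      rw [h3, hqc] at h2
      linear_combination h2 + hSp
    · rw [← sq_eq_sq₀ (norm_nonneg _) zero_le_one, ← real_inner_self_eq_norm_sq]
      simp only [inner_add_left, inner_add_right, inner_smul_left, inner_smul_right, hee, hfe,
          hff, hef]
      simp
      field_simp
      linarith
    · rw [hqe]
      simp only [inner_add_left, inner_smul_left, inner_smul_right, hee, hfe]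
      simp
      field_simp
  have hRsq : (Q * p₂) ^ 2 = (1 + b ^ 2) * (1 + c ^ 2) - S ^ 2 := by
    rw [hSp, ← hqc, ← hpp]; ring
  have hR0 : 0 ≤ Q * p₂ := mul_nonneg hQ0.le hp₂
  obtain ⟨hc0, hbcS, hbc⟩ := tan_bounds_of_insphere_lt hb hc hR0 hRsq hzlt
  obtain ⟨σ, hσdef⟩ : ∃ σ, σ = √(S ^ 2 - (b + c) ^ 2) := ⟨_, rfl⟩
  have hσpos : 0 < S ^ 2 - (b + c) ^ 2 := by nlinarith
  have hσ0 : 0 < σ := by rw [hσdef]; exact Real.sqrt_pos.2 hσpos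
  have hσ : σ ^ 2 = S ^ 2 - (b + c) ^ 2 := by rw [hσdef]; exact Real.sq_sqrt hσpos.le
  rw [← hσdef]
  -- `u · q` is controlled by the Cauchy-Schwarz inequality in the orthogonal complement of `p`
  have hsign : ∀ i, 0 ≤ c * S - (b + c) * ⟪u i, q⟫ := fun i => by
    obtain ⟨w, hw⟩ : ∃ w, w = ⟪u i, q⟫ := ⟨_, rfl⟩
    have hcs := real_inner_mul_inner_self_le ((1 + b ^ 2) • u i - p) ((1 + b ^ 2) • q - S • p)
    simp only [inner_sub_left, inner_sub_right, inner_smul_left, inner_smul_right,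
      real_inner_self_eq_norm_sq, hpb, ← hSdef, hp, real_inner_comm (u i) p, hu, ← hw,
      real_inner_comm p q] at hcs
    simp only [conj_trivial, ← hQ, hqc] at hcs
    have hcs' : ((1 + b ^ 2) * w - S) ^ 2 ≤ b ^ 2 * ((1 + b ^ 2) * (1 + c ^ 2) - S ^ 2) := by
      refine le_of_mul_le_mul_left ?_ (by positivity : 0 < (1 + b ^ 2) ^ 2)
      linear_combination hcs
    rw [← hw]
    exact sub_nonneg.2 (mul_le_mul_of_sq_le hb hS0 hbc hσ hcs')
  have hterm : ∀ i, c * σ + h i * ((c * (b * c - 1 - σ) - b * Q ^ 2) * (⟪u i, e⟫ * ⟪v i, e⟫)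
      + c * p₁ * ⟪v i, e⟫ + c * (b * c - 1 - σ) * (⟪u i, f⟫ * ⟪v i, f⟫) + c * p₂ * ⟪v i, f⟫)
      ≤ h i * (c * S - (b + c) * ⟪u i, q⟫) := fun i => by
    obtain ⟨s, hs⟩ : ∃ s, s = ⟪u i, e⟫ := ⟨_, rfl⟩
    obtain ⟨t, ht⟩ : ∃ t, t = ⟪u i, f⟫ := ⟨_, rfl⟩
    have hst : p₁ * s + p₂ * t = 1 := by
      rw [← hp i, hpe, inner_add_right, inner_smul_right, inner_smul_right, hs, ht]
    have huq : ⟪u i, q⟫ = Q * s := by rw [hqe, inner_smul_right, hs]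
    obtain ⟨x, hx⟩ : ∃ x, x = (c * (b * c - 1 - σ) - b * Q ^ 2) * s + c * p₁ := ⟨_, rfl⟩
    obtain ⟨y, hy⟩ : ∃ y, y = c * (b * c - 1 - σ) * t + c * p₂ := ⟨_, rfl⟩
    have hplane : ((b * c - 1) * t + p₂) ^ 2 + σ ^ 2 * (1 - s ^ 2 - t ^ 2)
        = (c * p₁ - (b + c) * s) ^ 2 := by
      rw [hSp] at hσ
      linear_combination (1 - s ^ 2 - t ^ 2) * hσ + p₁ ^ 2 * (1 - s ^ 2 - t ^ 2) * hqc
        + (1 - (1 + c ^ 2) * t ^ 2) * hpp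
        + ((1 + c ^ 2) * (t * p₂ + 1 - p₁ * s) + 2 * (b * c - 1)) * hst
    have hnorm : ‖(c * σ) • u i + (x • e + y • f)‖ ^ 2 = (c * S - (b + c) * ⟪u i, q⟫) ^ 2 := by
      rw [← real_inner_self_eq_norm_sq]
      simp only [inner_add_left, inner_add_right, inner_smul_left, inner_smul_right, hee, hfe, hff,
        hef, real_inner_self_eq_norm_sq, hu, real_inner_comm (u i) e, real_inner_comm (u i) f,
        ← hs, ← ht, huq, hSp]
      simp
      rw [hx, hy]
      linear_combination c ^ 2 * hplane - (b * s * (2 * (c * p₁ - (b + c) * s)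
        - b * s * (Q ^ 2 - 1 - c ^ 2)) + (c * p₁ - (b + c) * s) ^ 2) * hqc
    have hnorm' := (sq_eq_sq₀ (norm_nonneg _) (hsign i)).1 hnorm
    have hle := real_inner_le_norm ((c * σ) • u i + (x • e + y • f)) (v i)
    rw [hnorm', hv, mul_one] at hle
    refine le_trans (le_of_eq ?_) (mul_le_mul_of_nonneg_left hle (hh i).le)
    simp only [inner_add_left, inner_smul_left]
    simp
    rw [real_inner_comm (v i) e, real_inner_comm (v i) f, hx, hy, ← hs, ← ht]
    linear_combination -c * σ * hdiag i
  have hsum := Finset.sum_le_sum fun i (_ : i ∈ Finset.univ) => hterm i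
  have s₁ : ∑ i, h i * (⟪u i, e⟫ * ⟪v i, e⟫) = 1 := by
    rw [← hee, hexp e e]; simp_rw [real_inner_comm e]
  have s₂ : ∑ i, h i * (⟪u i, f⟫ * ⟪v i, f⟫) = 1 := by
    rw [← hff, hexp f f]; simp_rw [real_inner_comm f]
  have hsum_v : ∀ x, ∑ i, h i * ⟪v i, x⟫ = ⟪p, x⟫ := fun x => by
    rw [hexp p x]
    exact Finset.sum_congr rfl fun i _ => by
      rw [real_inner_comm (u i) p, hp, one_mul, real_inner_comm x]
  have s₃ : ∑ i, h i * ⟪v i, e⟫ = p₁ := by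
    rw [hsum_v, hpe]
    simp [inner_add_left, inner_smul_left, he, hfe]
  have s₄ : ∑ i, h i * ⟪v i, f⟫ = p₂ := by
    rw [hsum_v, hpe]
    simp [inner_add_left, inner_smul_left, hf, hef]
  have s₅ : ∑ i, h i * ⟪u i, q⟫ = 1 + c ^ 2 := by
    rw [← hqc, hQ, ← real_inner_self_eq_norm_sq, hexp q q]
    exact Finset.sum_congr rfl fun i _ => by
      rw [real_inner_comm (v i) q, hq, mul_one, real_inner_comm q]
  have hleft : ∑ i, (c * σ + h i * ((c * (b * c - 1 - σ) - b * Q ^ 2) * (⟪u i, e⟫ * ⟪v i, e⟫)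
      + c * p₁ * ⟪v i, e⟫ + c * (b * c - 1 - σ) * (⟪u i, f⟫ * ⟪v i, f⟫) + c * p₂ * ⟪v i, f⟫))
      = n * (c * σ) + (c * (b * c - 1 - σ) - b * Q ^ 2) * 1 + c * p₁ * p₁
        + c * (b * c - 1 - σ) * 1 + c * p₂ * p₂ := by
    calc _ = ∑ _i : Fin n, c * σ
          + (c * (b * c - 1 - σ) - b * Q ^ 2) * ∑ i, h i * (⟪u i, e⟫ * ⟪v i, e⟫)
          + c * p₁ * ∑ i, h i * ⟪v i, e⟫
          + c * (b * c - 1 - σ) * ∑ i, h i * (⟪u i, f⟫ * ⟪v i, f⟫)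
          + c * p₂ * ∑ i, h i * ⟪v i, f⟫ := by
            simp only [Finset.mul_sum, ← Finset.sum_add_distrib]
            exact Finset.sum_congr rfl fun i _ => by ring
      _ = _ := by rw [s₁, s₂, s₃, s₄]; simp
  have hright : ∑ i, h i * (c * S - (b + c) * ⟪u i, q⟫) = c * S * S - (b + c) * (1 + c ^ 2) := by
    rw [← s₅]
    nth_rewrite 3 [hS]
    simp only [Finset.mul_sum, ← Finset.sum_sub_distrib]
    exact Finset.sum_congr rfl fun i _ => by ring
  rw [hleft, hright] at hsum
  have hfin : c * σ * (n - 2) ≤ c * σ * σ := by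
    linear_combination hsum - c * hσ - c * hpp + b * hqc
  exact le_of_mul_le_mul_left hfin (mul_pos hc0 hσ0)

/-- The spherical Chapple-Euler relation for triangles. -/
lemma polar_triangles_identity {u v : Fin 3 → E} {h : Fin 3 → ℝ}
    (hu : ∀ i, ‖u i‖ = 1) (hv : ∀ i, ‖v i‖ = 1)
    (hpolar : ∀ i j, i ≠ j → ⟪u i, v j⟫ = 0)
    (hdiag : ∀ i, h i * ⟪u i, v i⟫ = 1)
    (hexp : ∀ x y : E, ⟪x, y⟫ = ∑ i, h i * (⟪x, u i⟫ * ⟪y, v i⟫))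
    (hp : ∀ i, ⟪u i, p⟫ = 1) (hq : ∀ i, ⟪v i, q⟫ = 1)
    (hpb : ‖p‖ ^ 2 = 1 + b ^ 2) (hqc : ‖q‖ ^ 2 = 1 + c ^ 2) :
    (⟪p, q⟫ ^ 2 - 1 - b ^ 2 - c ^ 2) ^ 2 = 4 * (b ^ 2 * c ^ 2) := by
  have hS : ⟪p, q⟫ = h 0 + h 1 + h 2 := by
    rw [hexp, Fin.sum_univ_three]
    simp only [fun i => (real_inner_comm (u i) p).trans (hp i),
      fun i => (real_inner_comm (v i) q).trans (hq i)]
    ring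
  have hpx : ∀ x, ⟪p, x⟫ = h 0 * ⟪x, v 0⟫ + h 1 * ⟪x, v 1⟫ + h 2 * ⟪x, v 2⟫ := fun x => by
    rw [hexp, Fin.sum_univ_three]
    simp only [fun i => (real_inner_comm (u i) p).trans (hp i)]
    ring
  have hqx : ∀ x, ⟪x, q⟫ = h 0 * ⟪x, u 0⟫ + h 1 * ⟪x, u 1⟫ + h 2 * ⟪x, u 2⟫ := fun x => by
    rw [hexp, Fin.sum_univ_three]
    simp only [fun i => (real_inner_comm (v i) q).trans (hq i)]
    ring
  have hvp : ∀ i, ⟪p, v i⟫ = h 0 * ⟪v i, v 0⟫ + h 1 * ⟪v i, v 1⟫ + h 2 * ⟪v i, v 2⟫ :=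
    fun i => hpx _
  have huu : ∀ i, ⟪u i, u i⟫ = 1 := fun i => by rw [real_inner_self_eq_norm_sq, hu, one_pow]
  have hvv : ∀ i, ⟪v i, v i⟫ = 1 := fun i => by rw [real_inner_self_eq_norm_sq, hv, one_pow]
  have hmul : ∀ i j, h 0 * (⟪u i, u 0⟫ * ⟪v j, v 0⟫) + h 1 * (⟪u i, u 1⟫ * ⟪v j, v 1⟫)
      + h 2 * (⟪u i, u 2⟫ * ⟪v j, v 2⟫) = ⟪u i, v j⟫ := fun i j => by
    rw [hexp (u i) (v j), Fin.sum_univ_three]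
  have hB : 1 + b ^ 2 = h 0 * ⟪p, v 0⟫ + h 1 * ⟪p, v 1⟫ + h 2 * ⟪p, v 2⟫ := by
    rw [← hpb, ← real_inner_self_eq_norm_sq, hpx p]
  have hC : 1 + c ^ 2 = h 0 * ⟪u 0, q⟫ + h 1 * ⟪u 1, q⟫ + h 2 * ⟪u 2, q⟫ := by
    rw [← hqc, ← real_inner_self_eq_norm_sq, hqx q]
    simp only [real_inner_comm]
  rw [hvp, hvp, hvp] at hB
  rw [hqx, hqx, hqx] at hC
  have d := fun i => hmul i i
  have m₀₁ := hmul 0 1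
  have m₀₂ := hmul 0 2
  have m₁₀ := hmul 1 0
  have m₁₂ := hmul 1 2
  have m₂₀ := hmul 2 0
  have m₂₁ := hmul 2 1
  have d₀ := hdiag 0
  have d₁ := hdiag 1
  have d₂ := hdiag 2
  rw [← d] at d₀ d₁ d₂
  rw [hpolar _ _ (by decide)] at m₀₁ m₀₂ m₁₀ m₁₂ m₂₀ m₂₁
  simp only [huu, hvv, real_inner_comm (u 0) (u 1), real_inner_comm (u 0) (u 2),
    real_inner_comm (u 1) (u 2), real_inner_comm (v 0) (v 1), real_inner_comm (v 0) (v 2),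
    real_inner_comm (v 1) (v 2)] at hB hC d₀ d₁ d₂ m₀₁ m₀₂ m₁₀ m₁₂ m₂₀ m₂₁
  rw [hS]
  refine triangle_gram_identity (h 0) (h 1) (h 2) ⟪u 0, u 1⟫ ⟪u 0, u 2⟫ ⟪u 1, u 2⟫
    ⟪v 0, v 1⟫ ⟪v 0, v 2⟫ ⟪v 1, v 2⟫ (b ^ 2) (c ^ 2) ?_ ?_ ?_ ?_ ?_ ?_ ?_ ?_ ?_ ?_ ?_
  · linear_combination d₀
  · linear_combination d₁
  · linear_combination d₂
  · linear_combination m₀₁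
  · linear_combination m₀₂
  · linear_combination m₁₀
  · linear_combination m₁₂
  · linear_combination m₂₀
  · linear_combination m₂₁
  · linear_combination hC
  · linear_combination hB

end Polar

/-- Main theorem: for mutually polar spherical simplices `U`, `V` in `S^{n-1}` (`n ≥ 3`) with
circumradii `β`, `γ` and circumcenters at spherical distance `α`, setting `b = tan β`,
`c = tan γ`, one has `√((bc-1)² cos²α - (b+c)² sin²α) ≥ n - 2`, with equality when `n = 3`. -/
theorem spherical_main_inequality
    (n : ℕ) (hn : 3 ≤ n)
    (u v : Fin n → EuclideanSpace ℝ (Fin n))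
    (hu_unit : ∀ i, ‖u i‖ = 1) (hv_unit : ∀ i, ‖v i‖ = 1)
    (hu_li : LinearIndependent ℝ u) (hv_li : LinearIndependent ℝ v)
    (hpolar : ∀ i j, i ≠ j → ⟪u i, v j⟫ = 0)
    (hpos : ∀ i, 0 < ⟪u i, v i⟫)
    (O₁ O₂ : EuclideanSpace ℝ (Fin n)) (hO₁ : ‖O₁‖ = 1) (hO₂ : ‖O₂‖ = 1)
    (α β γ : ℝ) (hβ : 0 ≤ β) (hβ' : β < π / 2) (hγ : 0 ≤ γ) (hγ' : γ < π / 2)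
    (hOu : ∀ i, ⟪u i, O₁⟫ = Real.cos β)
    (hOv : ∀ i, ⟪v i, O₂⟫ = Real.cos γ)
    (hα : α = Real.arccos ⟪O₁, O₂⟫) :
    Real.sqrt ((Real.tan β * Real.tan γ - 1) ^ 2 * Real.cos α ^ 2 -
        (Real.tan β + Real.tan γ) ^ 2 * Real.sin α ^ 2) ≥ (n : ℝ) - 2 ∧
    (n = 3 →
      Real.sqrt ((Real.tan β * Real.tan γ - 1) ^ 2 * Real.cos α ^ 2 -
        (Real.tan β + Real.tan γ) ^ 2 * Real.sin α ^ 2) = (n : ℝ) - 2) := by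
  have hcosβ : 0 < Real.cos β := Real.cos_pos_of_mem_Ioo ⟨by linarith [Real.pi_pos], hβ'⟩
  have hcosγ : 0 < Real.cos γ := Real.cos_pos_of_mem_Ioo ⟨by linarith [Real.pi_pos], hγ'⟩
  have hb : 0 ≤ Real.tan β := Real.tan_nonneg_of_nonneg_of_le_pi_div_two hβ hβ'.le
  have hc : 0 ≤ Real.tan γ := Real.tan_nonneg_of_nonneg_of_le_pi_div_two hγ hγ'.le
  have hsecβ : (Real.cos β)⁻¹ ^ 2 = 1 + Real.tan β ^ 2 := by
    rw [inv_pow, ← Real.inv_one_add_tan_sq hcosβ.ne', inv_inv]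
  have hsecγ : (Real.cos γ)⁻¹ ^ 2 = 1 + Real.tan γ ^ 2 := by
    rw [inv_pow, ← Real.inv_one_add_tan_sq hcosγ.ne', inv_inv]
  obtain ⟨p, hpdef⟩ : ∃ p, p = (Real.cos β)⁻¹ • O₁ := ⟨_, rfl⟩
  obtain ⟨q, hqdef⟩ : ∃ q, q = (Real.cos γ)⁻¹ • O₂ := ⟨_, rfl⟩
  have hp : ∀ i, ⟪u i, p⟫ = 1 := fun i => by
    rw [hpdef, inner_smul_right, hOu, inv_mul_cancel₀ hcosβ.ne']
  have hq : ∀ i, ⟪v i, q⟫ = 1 := fun i => by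
    rw [hqdef, inner_smul_right, hOv, inv_mul_cancel₀ hcosγ.ne']
  have hpb : ‖p‖ ^ 2 = 1 + Real.tan β ^ 2 := by
    rw [hpdef, norm_smul, hO₁, mul_one, Real.norm_eq_abs, sq_abs, hsecβ]
  have hqc : ‖q‖ ^ 2 = 1 + Real.tan γ ^ 2 := by
    rw [hqdef, norm_smul, hO₂, mul_one, Real.norm_eq_abs, sq_abs, hsecγ]
  have hcosα : Real.cos α = ⟪O₁, O₂⟫ := by
    have := abs_le.1 (abs_real_inner_le_norm O₁ O₂)
    rw [hO₁, hO₂, mul_one] at this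
    rw [hα, Real.cos_arccos this.1 this.2]
  have hpq : ⟪p, q⟫ ^ 2 = (1 + Real.tan β ^ 2) * (1 + Real.tan γ ^ 2) * Real.cos α ^ 2 := by
    rw [← hsecβ, ← hsecγ, hcosα, hpdef, hqdef, inner_smul_left, inner_smul_right, conj_trivial]
    ring
  have hrad : (Real.tan β * Real.tan γ - 1) ^ 2 * Real.cos α ^ 2 -
      (Real.tan β + Real.tan γ) ^ 2 * Real.sin α ^ 2
      = ⟪p, q⟫ ^ 2 - (Real.tan β + Real.tan γ) ^ 2 := by
    rw [hpq, Real.sin_sq]; ring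
  have hdiag : ∀ i, ⟪u i, v i⟫⁻¹ * ⟪u i, v i⟫ = 1 := fun i => inv_mul_cancel₀ (hpos i).ne'
  have hexp := polar_inner_expansion u v hv_li hpolar hpos
  have hbound := polar_simplices_bound (by simp; omega) hn hu_unit hv_unit hv_li.injective hpolar
    (fun i => inv_pos.2 (hpos i)) hdiag hexp hp hq hb hc hpb hqc
  rw [hrad]
  refine ⟨hbound, ?_⟩
  rintro rfl
  have hid := polar_triangles_identity hu_unit hv_unit hpolar hdiag hexp hp hq hpb hqc
  norm_num at hbound ⊢
  have hpos' : 0 ≤ ⟪p, q⟫ ^ 2 - 1 - Real.tan β ^ 2 - Real.tan γ ^ 2 := by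
    nlinarith [mul_nonneg hb hc]
  have hroot : ⟪p, q⟫ ^ 2 - 1 - Real.tan β ^ 2 - Real.tan γ ^ 2 = 2 * (Real.tan β * Real.tan γ) :=
    (sq_eq_sq₀ hpos' (by positivity)).1 (by rw [hid]; ring)
  linarith
end
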